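/- Let S be a set of seven distinct lines in Pic S₈ pairwise intersecting in 1 (an A₆⁸(1)-polytope). If a 3-element subset T of S is not contained in any 4-element subset of S forming a cornered A₃⁸(1)-polytope (i.e., T is a Fano block), then the complementary four lines S \ T form a cornered A₃⁸(1)-polytope. -/

import Mathlib

/-!
Picard lattice of the degree 1 del Pezzo surface S₈:
Pic S₈ = ℤh ⊕ ℤe₁ ⊕ ⋯ ⊕ ℤe₈ ≅ ℤ⁹, with intersection pairing
h·h = 1, h·eᵢ = 0, eᵢ·eⱼ = −δᵢⱼ, and canonical class K = −3h + e₁ + ⋯ + e₈.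
-/

namespace DelPezzo

/-- The Picard lattice `Pic S₈ ≅ ℤ⁹`; coordinate `0` is the `h`-coordinate and
coordinates `1,…,8` are the `e₁,…,e₈`-coordinates. -/
abbrev Pic : Type := Fin 9 → ℤ

/-- The intersection pairing on `Pic S₈` (signature `(1,-8)`). -/
def inter (x y : Pic) : ℤ := x 0 * y 0 - ∑ i : Fin 8, x i.succ * y i.succ

/-- The canonical class `K = -3h + e₁ + ⋯ + e₈`. -/
def K : Pic := fun i => if i = 0 then -3 else 1

/-- A line: a class `l` with `l·l = -1` and `l·K = -1`. -/
def IsLine (l : Pic) : Prop := inter l l = -1 ∧ inter l K = -1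

/-- A finite set of lines is cornered if some line has intersection `0` with all of them. -/
def IsCornered (T : Finset Pic) : Prop := ∃ m : Pic, IsLine m ∧ ∀ x ∈ T, inter m x = 0

theorem inter_comm (x y : Pic) : inter x y = inter y x := by
  simp only [inter, mul_comm]

theorem inter_add_left (x y z : Pic) : inter (x + y) z = inter x z + inter y z := by
  simp only [inter, Pi.add_apply, add_mul, Finset.sum_add_distrib]
  ring

theorem inter_smul_left (a : ℤ) (x y : Pic) : inter (a • x) y = a * inter x y := by
  simp only [inter, Pi.smul_apply, smul_eq_mul, mul_assoc, ← Finset.mul_sum]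
  ring

theorem inter_sub_left (x y z : Pic) : inter (x - y) z = inter x z - inter y z := by
  simp only [inter, Pi.sub_apply, sub_mul, Finset.sum_sub_distrib]
  ring

theorem inter_sum_left {ι : Type*} (I : Finset ι) (f : ι → Pic) (y : Pic) :
    inter (∑ i ∈ I, f i) y = ∑ i ∈ I, inter (f i) y := by
  classical
  induction I using Finset.induction_on with
  | empty => simp [inter]
  | insert a s ha ih => rw [Finset.sum_insert ha, Finset.sum_insert ha, inter_add_left, ih]

theorem inter_K_K : inter K K = 1 := by decide

/-- The canonical class is characteristic. -/
theorem even_inter_self_add_inter_K (x : Pic) : Even (inter x x + inter x K) := by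
  have h (a : ℤ) : Even (a * (a + 1)) := Int.even_mul_succ_self a
  have hsum : inter x x + inter x K =
      x 0 * (x 0 + 1) - ∑ i : Fin 8, x i.succ * (x i.succ + 1) - 2 * (2 * x 0) := by
    simp only [inter, K, Fin.succ_ne_zero, if_true, if_false, mul_add, Finset.sum_add_distrib]
    ring
  rw [hsum]
  exact ((h _).sub (Finset.even_sum _ fun i _ => h _)).sub (even_two_mul _)

theorem dotProduct_intCast (x y : Pic) :
    (fun k => (x k : ZMod 2)) ⬝ᵥ (fun k => (y k : ZMod 2)) = (inter x y : ZMod 2) := by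
  simp only [dotProduct, inter, Fin.sum_univ_succ (n := 8), CharTwo.sub_eq_add, Int.cast_sub,
    Int.cast_mul, Int.cast_sum]

theorem inter_add_K_add_K {x y : Pic} (hx : inter x K = -1) (hy : inter y K = -1) :
    inter (x + K) (y + K) = inter x y - 1 := by
  rw [inter_add_left, inter_comm x, inter_comm K, inter_add_left, inter_add_left, inter_K_K,
    inter_comm K x, hx, hy, inter_comm y x]
  ring

/-- If the sum of the roots `x + K` over a set of at most seven pairwise intersecting lines is
divisible by two, then half of it is a root, and the corresponding line is a corner. -/
theorem card_eq_four_and_isCornered {I : Finset Pic} (hne : I.Nonempty) (hcard : I.card ≤ 7)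
    (hline : ∀ x ∈ I, IsLine x)
    (hint : ∀ x ∈ I, ∀ y ∈ I, x ≠ y → inter x y = 1)
    (heven : ∀ k, (2 : ℤ) ∣ ∑ x ∈ I, (x + K) k) :
    I.card = 4 ∧ IsCornered I := by
  choose b hb using heven
  have hsum : (2 : ℤ) • b = ∑ x ∈ I, (x + K) := by
    ext k
    rw [Finset.sum_apply, hb k]
    simp
  have hroot : ∀ y ∈ I, inter b (y + K) = -1 := by
    intro y hy
    have h : 2 * inter b (y + K) = -2 := by
      rw [← inter_smul_left, hsum, inter_sum_left, Finset.sum_eq_single_of_mem y hy]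
      · rw [inter_add_K_add_K (hline y hy).2 (hline y hy).2, (hline y hy).1]
        norm_num
      · intro x hx hxy
        rw [inter_add_K_add_K (hline x hx).2 (hline y hy).2, hint x hx y hy hxy, sub_self]
    linarith
  have hbK : inter b K = 0 := by
    have h : 2 * inter b K = 0 := by
      rw [← inter_smul_left, hsum, inter_sum_left]
      refine Finset.sum_eq_zero fun x hx => ?_
      rw [inter_add_left, (hline x hx).2, inter_K_K]
      norm_num
    linarith
  have hbb : 2 * inter b b = -I.card := by
    rw [← inter_smul_left, hsum, inter_sum_left,
      Finset.sum_congr rfl fun x hx => (inter_comm _ _).trans (hroot x hx)]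
    simp
  have hpos := hne.card_pos
  obtain ⟨r, hr⟩ := even_inter_self_add_inter_K b
  have hfour : I.card = 4 := by omega
  refine ⟨hfour, b - K, ⟨?_, ?_⟩, fun x hx => ?_⟩
  · rw [inter_sub_left, inter_comm b, inter_comm K, inter_sub_left, inter_sub_left, inter_K_K,
      inter_comm K b, hbK]
    omega
  · rw [inter_sub_left, hbK, inter_K_K]
    norm_num
  · have h := hroot x hx
    rw [inter_comm, inter_add_left, inter_comm K, hbK, inter_comm] at h
    rw [inter_sub_left, inter_comm K, (hline x hx).2]
    linarith

/-- Matrix whose rows are the roots `x + K`, `x ∈ S`, modulo two. -/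
def rootMatrix (S : Finset Pic) : Matrix S (Fin 9) (ZMod 2) :=
  Matrix.of fun x k => ((x.1 + K) k : ZMod 2)

theorem rootMatrix_mul_transpose {S : Finset Pic} (hline : ∀ x ∈ S, IsLine x)
    (hint : ∀ x ∈ S, ∀ y ∈ S, x ≠ y → inter x y = 1) :
    rootMatrix S * (rootMatrix S).transpose = 0 := by
  ext x y
  have h : (rootMatrix S * (rootMatrix S).transpose) x y =
      (inter (x.1 + K) (y.1 + K) : ZMod 2) := dotProduct_intCast _ _
  rw [h, inter_add_K_add_K (hline x x.2).2 (hline y y.2).2]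
  by_cases hxy : x = y
  · subst hxy
    rw [(hline x x.2).1]
    exact (ZMod.intCast_zmod_eq_zero_iff_dvd _ 2).2 (by norm_num)
  · rw [hint x x.2 y y.2 (Subtype.coe_ne_coe.2 hxy)]
    simp

/-- The binary code of linear relations modulo two between the roots `x + K`, `x ∈ S`. -/
def relationCode (S : Finset Pic) : Submodule (ZMod 2) (S → ZMod 2) :=
  LinearMap.ker (rootMatrix S).transpose.mulVecLin

theorem three_le_finrank_relationCode {S : Finset Pic} (hcard : S.card = 7)
    (hline : ∀ x ∈ S, IsLine x)
    (hint : ∀ x ∈ S, ∀ y ∈ S, x ≠ y → inter x y = 1) :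
    3 ≤ Module.finrank (ZMod 2) (relationCode S) := by
  have h₁ := Matrix.rank_add_rank_le_card_of_mul_eq_zero (rootMatrix_mul_transpose hline hint)
  have h₂ := LinearMap.finrank_range_add_finrank_ker (rootMatrix S).transpose.mulVecLin
  change (rootMatrix S).transpose.rank + Module.finrank (ZMod 2) (relationCode S) = _ at h₂
  rw [Matrix.rank_transpose] at h₁ h₂
  simp only [Module.finrank_fintype_fun_eq_card, Fintype.card_coe, hcard] at h₂
  simp only [Fintype.card_fin] at h₁
  omega

/-- The support of a word, as a set of lines. -/
def wordSupport {S : Finset Pic} (c : S → ZMod 2) : Finset Pic :=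
  (Finset.univ.filter fun x => c x = 1).map (Function.Embedding.subtype _)

theorem mem_wordSupport {S : Finset Pic} {c : S → ZMod 2} {x : Pic} :
    x ∈ wordSupport c ↔ ∃ h : x ∈ S, c ⟨x, h⟩ = 1 := by
  simp [wordSupport]

theorem wordSupport_subset {S : Finset Pic} (c : S → ZMod 2) : wordSupport c ⊆ S :=
  fun _ hx => (mem_wordSupport.1 hx).1

theorem two_dvd_sum_wordSupport {S : Finset Pic} {c : S → ZMod 2} (hc : c ∈ relationCode S)
    (k : Fin 9) : (2 : ℤ) ∣ ∑ x ∈ wordSupport c, (x + K) k := by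
  have h : ∑ x : S, ((x.1 + K) k : ZMod 2) * c x = 0 := congrFun (LinearMap.mem_ker.1 hc) k
  refine (ZMod.intCast_zmod_eq_zero_iff_dvd _ 2).1 ?_
  rw [← h, wordSupport, Finset.sum_map, Finset.sum_filter, Int.cast_sum]
  refine Finset.sum_congr rfl fun x _ => ?_
  obtain hx | hx : c x = 0 ∨ c x = 1 := by generalize c x = a; revert a; decide
  · simp [hx]
  · simp [hx]

theorem fano_block_complement_cornered (S : Finset Pic) (hcard : S.card = 7)
    (hline : ∀ x ∈ S, IsLine x)
    (hint : ∀ x ∈ S, ∀ y ∈ S, x ≠ y → inter x y = 1)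
    (T : Finset Pic) (hTS : T ⊆ S) (hT3 : T.card = 3)
    (hfano : ¬ ∃ U : Finset Pic, U ⊆ S ∧ U.card = 4 ∧ T ⊆ U ∧ IsCornered U) :
    (S \ T).card = 4 ∧ IsCornered (S \ T) := by
  have hcompl : (S \ T).card = 4 := by
    rw [Finset.card_sdiff_of_subset hTS, hcard, hT3]
  refine ⟨hcompl, ?_⟩
  have hword (c : S → ZMod 2) (hc : c ∈ relationCode S) (hne : (wordSupport c).Nonempty) :
      (wordSupport c).card = 4 ∧ IsCornered (wordSupport c) :=
    have hsub := wordSupport_subset c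
    card_eq_four_and_isCornered hne (hcard ▸ Finset.card_le_card hsub)
      (fun x hx => hline x (hsub hx)) (fun x hx y hy => hint x (hsub hx) y (hsub hy))
      (two_dvd_sum_wordSupport hc)
  let ρ : relationCode S →ₗ[ZMod 2] (T → ZMod 2) :=
    LinearMap.funLeft (ZMod 2) (ZMod 2) (Set.inclusion hTS) ∘ₗ (relationCode S).subtype
  have hker : ¬ Function.Injective ρ := by
    intro hinj
    have hfin : Module.finrank (ZMod 2) (relationCode S) = Module.finrank (ZMod 2) (T → ZMod 2) :=
      (LinearMap.finrank_le_finrank_of_injective hinj).antisymm <| by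
        simpa [hT3] using three_le_finrank_relationCode hcard hline hint
    obtain ⟨c, hc⟩ :=
      (LinearMap.injective_iff_surjective_of_finrank_eq_finrank hfin).1 hinj fun _ => 1
    have hT : T ⊆ wordSupport c.1 := fun x hx =>
      mem_wordSupport.2 ⟨hTS hx, congrFun hc ⟨x, hx⟩⟩
    have hne : T.Nonempty := Finset.card_pos.1 (by omega)
    obtain ⟨h₄, hcorner⟩ := hword c c.2 (hne.mono hT)
    exact hfano ⟨_, wordSupport_subset _, h₄, hT, hcorner⟩
  rw [← LinearMap.ker_eq_bot, Submodule.eq_bot_iff] at hker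
  push Not at hker
  obtain ⟨c, hc, hc0⟩ := hker
  have hne : (wordSupport c.1).Nonempty := by
    by_contra hempty
    refine hc0 (Subtype.ext (funext fun x => ?_))
    by_contra hx
    have hx1 : c.1 x = 1 := Fin.eq_one_of_ne_zero _ hx
    exact hempty ⟨x, mem_wordSupport.2 ⟨x.2, hx1⟩⟩
  obtain ⟨h₄, hcorner⟩ := hword c c.2 hne
  have hsub : wordSupport c.1 ⊆ S \ T := by
    intro x hx
    obtain ⟨hxS, hx1⟩ := mem_wordSupport.1 hx
    refine Finset.mem_sdiff.2 ⟨hxS, fun hxT => ?_⟩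
    have hx0 : c.1 ⟨x, hxS⟩ = 0 := congrFun (LinearMap.mem_ker.1 hc) ⟨x, hxT⟩
    exact zero_ne_one (hx0.symm.trans hx1)
  rwa [← Finset.eq_of_subset_of_card_le hsub (by omega)]

end DelPezzo
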